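/- For every integer δ ≥ 1 there exists an integer M such that for every integer m ≥ M, setting e = m − δ, the following holds: every numerical monoid Γ with embedding dimension e+1 and multiplicity m satisfies type(Γ) ≤ 𝒟(e,m), and there exists a numerical monoid Γ with embedding dimension e+1, multiplicity m, and type(Γ) = 𝒟(e,m). (That is, for each fixed value of m−e, the maximum 𝒯(e,m) of type(Γ) over all numerical monoids with embedding dimension e+1 and multiplicity m equals 𝒟(e,m) for all m ≫ 0.) -/

import Mathlib

open scoped Pointwise

/-- A numerical monoid: an additive submonoid of ℕ with finite complement. -/
def IsNumericalMonoid (Γ : AddSubmonoid ℕ) : Prop :=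
  ((Γ : Set ℕ)ᶜ).Finite

/-- The (unique) minimal generating set of a submonoid of ℕ: the nonzero elements
that are not sums of two nonzero elements. -/
def minGens (Γ : AddSubmonoid ℕ) : Set ℕ :=
  {g | g ∈ Γ ∧ g ≠ 0 ∧ ∀ a ∈ Γ, ∀ b ∈ Γ, a ≠ 0 → b ≠ 0 → g ≠ a + b}

/-- Embedding dimension: the number of minimal generators. -/
noncomputable def edim (Γ : AddSubmonoid ℕ) : ℕ :=
  (minGens Γ).ncard

/-- Multiplicity: the smallest nonzero element. -/
noncomputable def mult (Γ : AddSubmonoid ℕ) : ℕ :=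
  sInf {g : ℕ | g ∈ Γ ∧ g ≠ 0}

/-- The factorization homomorphism φ, sending a formal ℕ-combination of the minimal
generators to its value in ℕ. -/
noncomputable def factorizationHom (Γ : AddSubmonoid ℕ) : (minGens Γ →₀ ℕ) →+ ℕ :=
  Finsupp.liftAddHom fun g => AddMonoidHom.mulLeft (g : ℕ)

/-- The number of minimal relations ρ(Γ): the least cardinality of a set of pairs
generating the kernel congruence of the factorization homomorphism. -/
noncomputable def rho (Γ : AddSubmonoid ℕ) : ℕ :=
  sInf {n : ℕ | ∃ R : Set ((minGens Γ →₀ ℕ) × (minGens Γ →₀ ℕ)),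
    R.Finite ∧ R.ncard = n ∧
    addConGen (fun a b => (a, b) ∈ R) = AddCon.ker (factorizationHom Γ)}

/-- Pseudo-Frobenius numbers of Γ. -/
def pseudoFrobenius (Γ : AddSubmonoid ℕ) : Set ℕ :=
  {p | p ∉ Γ ∧ ∀ g ∈ Γ, g ≠ 0 → p + g ∈ Γ}

/-- The type of Γ: the number of pseudo-Frobenius numbers. -/
noncomputable def numType (Γ : AddSubmonoid ℕ) : ℕ :=
  (pseudoFrobenius Γ).ncard

/-- The Apéry set of Γ with respect to its multiplicity. -/
def aperySet (Γ : AddSubmonoid ℕ) : Set ℕ :=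
  {g | g ∈ Γ ∧ ¬ ∃ γ ∈ Γ, g = γ + mult Γ}

/-- The Macaulay upper function: if `n = C(n_d,d) + ⋯ + C(n_j,j)` is the Macaulay
expansion of `n`, then `macUpper d n = C(n_d+1,d+1) + ⋯ + C(n_j+1,j+1)`, i.e. `n^⟨d⟩`. -/
noncomputable def macUpper : ℕ → ℕ → ℕ
  | 0, _ => 0
  | d + 1, n =>
    if n = 0 then 0
    else
      Nat.choose (sSup {a : ℕ | Nat.choose a (d + 1) ≤ n} + 1) (d + 2) +
        macUpper d (n - Nat.choose (sSup {a : ℕ | Nat.choose a (d + 1) ≤ n}) (d + 1))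

/-- The Macaulay lower function: if `n = C(n_d,d) + ⋯ + C(n_j,j)` is the Macaulay
expansion of `n`, then `macLower d n = C(n_d-1,d) + ⋯ + C(n_j-1,j)`, i.e. `n_⟨d⟩`. -/
noncomputable def macLower : ℕ → ℕ → ℕ
  | 0, _ => 0
  | d + 1, n =>
    if n = 0 then 0
    else
      Nat.choose (sSup {a : ℕ | Nat.choose a (d + 1) ≤ n} - 1) (d + 1) +
        macLower d (n - Nat.choose (sSup {a : ℕ | Nat.choose a (d + 1) ≤ n}) (d + 1))

/-- The unique positive `r` with `C(e+r-1,r-1) ≤ m < C(e+r,r)`. -/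
noncomputable def macR (e m : ℕ) : ℕ :=
  sInf {r : ℕ | 0 < r ∧ m < Nat.choose (e + r) r}

/-- The bound 𝒞(e,m) = C(e+r-1,r) + s^⟨r⟩ - s, where s = m - C(e+r-1,r-1). -/
noncomputable def mathcalC (e m : ℕ) : ℕ :=
  Nat.choose (e + macR e m - 1) (macR e m) +
      macUpper (macR e m) (m - Nat.choose (e + macR e m - 1) (macR e m - 1)) -
    (m - Nat.choose (e + macR e m - 1) (macR e m - 1))

/-- The bound 𝒟(e,m) = C(e+r-2,r-1) + s_⟨r⟩, where s = m - C(e+r-1,r-1). -/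
noncomputable def mathcalD (e m : ℕ) : ℕ :=
  Nat.choose (e + macR e m - 2) (macR e m - 1) +
    macLower (macR e m) (m - Nat.choose (e + macR e m - 1) (macR e m - 1))


theorem macLower_one (n : ℕ) : macLower 1 n = n - 1 := by
  have h : {a : ℕ | Nat.choose a (0 + 1) ≤ n} = Set.Iic n := by
    ext a
    simp
  by_cases hn : n = 0
  · simp [macLower, hn]
  · rw [macLower, h, csSup_Iic]
    simp [macLower, hn]

/-- The deficit `s - s_⟨2⟩` is the least `k` with `s ≤ C(k+1,2)`. -/
theorem exists_macLower_two_add (s : ℕ) :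
    ∃ k, macLower 2 s + k = s ∧ s ≤ Nat.choose (k + 1) 2 ∧
      ∀ n, s ≤ Nat.choose (n + 1) 2 → k ≤ n := by
  by_cases hs : s = 0
  · exact ⟨0, by simp [macLower, hs]⟩
  set S : Set ℕ := {a : ℕ | Nat.choose a (1 + 1) ≤ s} with hS
  have hbdd : BddAbove S := by
    refine ⟨s + 1, fun a ha => ?_⟩
    by_contra! hlt
    have h1 : Nat.choose (s + 2) 2 ≤ Nat.choose a 2 := Nat.choose_le_choose 2 hlt
    have h2 : Nat.choose (s + 2) 2 = (s + 1) + Nat.choose (s + 1) 2 := by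
      rw [Nat.choose_succ_succ' (s + 1) 1, Nat.choose_one_right]
    have h3 : Nat.choose a 2 ≤ s := ha
    omega
  have hmem : sSup S ∈ S := Nat.sSup_mem ⟨0, by simp [hS]⟩ hbdd
  have hle : Nat.choose (sSup S) 2 ≤ s := hmem
  have hlt : s < Nat.choose (sSup S + 1) 2 := by
    by_contra! h
    have := le_csSup hbdd (show sSup S + 1 ∈ S from h)
    omega
  have hval : macLower 2 s =
      Nat.choose (sSup S - 1) 2 + (s - Nat.choose (sSup S) 2 - 1) := by
    rw [macLower, if_neg hs, macLower_one]
  have h2S : 2 ≤ sSup S :=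
    le_csSup hbdd (show Nat.choose 2 2 ≤ s by simpa using Nat.one_le_iff_ne_zero.2 hs)
  obtain ⟨b, hb⟩ : ∃ b, sSup S = b + 1 := ⟨sSup S - 1, by omega⟩
  rw [hval]
  rw [hb] at hle hlt ⊢
  have hpascal : Nat.choose (b + 1) 2 = b + Nat.choose b 2 := by
    rw [Nat.choose_succ_succ' b 1, Nat.choose_one_right]
  simp only [Nat.add_sub_cancel]
  by_cases heq : s = Nat.choose (b + 1) 2
  · refine ⟨b, by omega, by omega, fun n hn => ?_⟩
    by_contra! h
    have : Nat.choose (n + 1) 2 ≤ Nat.choose b 2 := Nat.choose_le_choose 2 h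
    omega
  · refine ⟨b + 1, by omega, by omega, fun n hn => ?_⟩
    by_contra! h
    have : Nat.choose (n + 1) 2 ≤ Nat.choose (b + 1) 2 := Nat.choose_le_choose 2 h
    omega

theorem macR_eq_two {e m : ℕ} (h1 : e + 1 ≤ m) (h2 : m < Nat.choose (e + 2) 2) :
    macR e m = 2 := by
  have hmem : (2 : ℕ) ∈ {r : ℕ | 0 < r ∧ m < Nat.choose (e + r) r} := ⟨by norm_num, h2⟩
  have hle : macR e m ≤ 2 := Nat.sInf_le hmem
  obtain ⟨hpos, hlt⟩ : 0 < macR e m ∧ m < Nat.choose (e + macR e m) (macR e m) :=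
    Nat.sInf_mem ⟨2, hmem⟩
  by_contra hne
  have : macR e m = 1 := by omega
  rw [this, Nat.choose_one_right] at hlt
  omega

theorem mathcalD_eq {e m : ℕ} (h1 : e + 1 ≤ m) (h2 : m < Nat.choose (e + 2) 2) :
    mathcalD e m = e + macLower 2 (m - (e + 1)) := by
  simp [mathcalD, macR_eq_two h1 h2]

theorem mult_le {Γ : AddSubmonoid ℕ} {g : ℕ} (hg : g ∈ Γ) (h0 : g ≠ 0) : mult Γ ≤ g :=
  Nat.sInf_le ⟨hg, h0⟩

theorem mult_mem {Γ : AddSubmonoid ℕ} (h : mult Γ ≠ 0) : mult Γ ∈ Γ :=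
  (Nat.sInf_mem (Nat.nonempty_of_sInf_eq_succ (Nat.succ_pred_eq_of_ne_zero h).symm)).1

theorem left_mem_aperySet {Γ : AddSubmonoid ℕ} {a b : ℕ} (ha : a ∈ Γ) (hb : b ∈ Γ)
    (h : a + b ∈ aperySet Γ) : a ∈ aperySet Γ := by
  refine ⟨ha, fun ⟨γ, hγ, e⟩ => h.2 ⟨γ + b, Γ.add_mem hγ hb, ?_⟩⟩
  omega

theorem add_mult_mem_aperySet {Γ : AddSubmonoid ℕ} (h : mult Γ ≠ 0) {p : ℕ}
    (hp : p ∈ pseudoFrobenius Γ) : p + mult Γ ∈ aperySet Γ := by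
  refine ⟨hp.2 _ (mult_mem h) h, fun ⟨γ, hγ, e⟩ => hp.1 ?_⟩
  rwa [Nat.add_right_cancel e]

theorem bijOn_mod_aperySet {Γ : AddSubmonoid ℕ} (hΓ : IsNumericalMonoid Γ)
    (h : mult Γ ≠ 0) : Set.BijOn (· % mult Γ) (aperySet Γ) (Set.Iio (mult Γ)) := by
  have hmul : ∀ x ∈ Γ, ∀ c, x + c * mult Γ ∈ Γ := fun x hx c =>
    Γ.add_mem hx (by simpa using Γ.nsmul_mem (mult_mem h) c)
  have hwlog : ∀ x ∈ aperySet Γ, ∀ y ∈ aperySet Γ, x % mult Γ = y % mult Γ → x ≤ y → x = y := by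
    intro x hx y hy hxy hle
    obtain ⟨c, hc⟩ := (Nat.modEq_iff_dvd' hle).1 hxy
    rcases c with _ | c
    · simp at hc
      omega
    · refine absurd ⟨x + c * mult Γ, hmul x hx.1 c, ?_⟩ hy.2
      rw [mul_add, mul_comm (mult Γ) c] at hc
      omega
  refine ⟨fun x _ => Nat.mod_lt _ (Nat.pos_of_ne_zero h), fun x hx y hy hxy => ?_, fun i hi => ?_⟩
  · rcases le_total x y with hle | hle
    · exact hwlog x hx y hy hxy hle
    · exact (hwlog y hy x hx hxy.symm hle).symm
  · have hex : ∃ x, x ∈ Γ ∧ x % mult Γ = i := by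
      obtain ⟨B, hB⟩ := hΓ.bddAbove
      refine ⟨i + (B + 1) * mult Γ, ?_, ?_⟩
      · by_contra hx
        have h1 : i + (B + 1) * mult Γ ≤ B := hB hx
        have h2 : B + 1 ≤ (B + 1) * mult Γ := Nat.le_mul_of_pos_right _ (Nat.pos_of_ne_zero h)
        omega
      · rw [Nat.add_mul_mod_self_right, Nat.mod_eq_of_lt hi]
    classical
    refine ⟨Nat.find hex, ⟨(Nat.find_spec hex).1, fun ⟨γ, hγ, e⟩ => ?_⟩, (Nat.find_spec hex).2⟩
    refine Nat.find_min hex (m := γ) (by omega) ⟨hγ, ?_⟩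
    rw [← (Nat.find_spec hex).2, e, Nat.add_mod_right]

theorem mult_mem_minGens {Γ : AddSubmonoid ℕ} (h : mult Γ ≠ 0) : mult Γ ∈ minGens Γ := by
  refine ⟨mult_mem h, h, fun a ha b hb ha0 hb0 e => ?_⟩
  have := mult_le ha ha0
  omega

theorem minGens_diff_subset_aperySet {Γ : AddSubmonoid ℕ} (h : mult Γ ≠ 0) :
    minGens Γ \ {mult Γ} ⊆ aperySet Γ \ {0} := by
  rintro g ⟨hg, hne⟩
  refine ⟨⟨hg.1, fun ⟨γ, hγ, e⟩ => ?_⟩, hg.2.1⟩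
  by_cases h0 : γ = 0
  · exact hne (by simpa [h0] using e)
  · exact hg.2.2 γ hγ _ (mult_mem h) h0 h e

/-- If `n` is the number of nonzero elements of the Apéry set that are not maximal, then each
of the decomposable elements is a sum of two of these `n` elements. -/
theorem exists_numType_add_eq {Γ : AddSubmonoid ℕ} (hΓ : IsNumericalMonoid Γ)
    (h : mult Γ ≠ 0) (hfin : (minGens Γ).Finite) :
    ∃ n, numType Γ + n + 1 = mult Γ ∧ mult Γ ≤ edim Γ + Nat.choose (n + 1) 2 := by
  classical
  have hbij := bijOn_mod_aperySet hΓ h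
  have hAfin : (aperySet Γ).Finite := hbij.finite_iff_finite.2 (Set.finite_Iio _)
  have hAcard : (aperySet Γ).ncard = mult Γ := by
    rw [← hbij.injOn.ncard_image, hbij.image_eq, Set.ncard_Iio_nat]
  have h0 : (0 : ℕ) ∈ aperySet Γ := ⟨Γ.zero_mem, fun ⟨γ, _, e⟩ => h (by omega)⟩
  have hA'card : (aperySet Γ \ {0}).ncard + 1 = mult Γ := by
    rw [Set.ncard_sdiff_singleton_add_one h0 hAfin, hAcard]
  have hA'fin : (aperySet Γ \ {0}).Finite := hAfin.sdiff
  set Q : Set ℕ := (· + mult Γ) '' pseudoFrobenius Γ with hQ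
  have hQsub : Q ⊆ aperySet Γ \ {0} := by
    rintro _ ⟨p, hp, rfl⟩
    exact ⟨add_mult_mem_aperySet h hp, by simp [h]⟩
  have hQcard : Q.ncard = numType Γ := Set.ncard_image_of_injective _ (add_left_injective _)
  set N : Set ℕ := (aperySet Γ \ {0}) \ Q with hN
  have hNcard : N.ncard + Q.ncard = (aperySet Γ \ {0}).ncard :=
    Set.ncard_sdiff_add_ncard_of_subset hQsub hA'fin
  have hNfin : N.Finite := hA'fin.sdiff
  have hGcard : (minGens Γ \ {mult Γ}).ncard + 1 = edim Γ :=
    Set.ncard_sdiff_singleton_add_one (mult_mem_minGens h) hfin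
  set D : Set ℕ := (aperySet Γ \ {0}) \ (minGens Γ \ {mult Γ}) with hD
  have hDcard : D.ncard + (minGens Γ \ {mult Γ}).ncard = (aperySet Γ \ {0}).ncard :=
    Set.ncard_sdiff_add_ncard_of_subset (minGens_diff_subset_aperySet h) hA'fin
  refine ⟨N.ncard, by omega, ?_⟩
  have hnotQ : ∀ a b, b ∈ Γ → b ≠ 0 → a + b ∈ aperySet Γ → a ∉ Q := by
    rintro _ b hb hb0 hab ⟨p, hp, rfl⟩
    exact hab.2 ⟨p + b, hp.2 b hb hb0, by simp only; omega⟩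
  let f : Sym2 ℕ → ℕ := Sym2.lift ⟨fun a b => a + b, Nat.add_comm⟩
  have hDsub : D ⊆ (hNfin.toFinset.sym2.image f : Finset ℕ) := by
    rintro d ⟨⟨hdA, hd0⟩, hdG⟩
    have hdm : d ≠ mult Γ := fun e => hdA.2 ⟨0, Γ.zero_mem, by omega⟩
    have hdec : ¬ ∀ a ∈ Γ, ∀ b ∈ Γ, a ≠ 0 → b ≠ 0 → d ≠ a + b :=
      fun hd => hdG ⟨⟨hdA.1, hd0, hd⟩, hdm⟩
    push Not at hdec
    obtain ⟨a, ha, b, hb, ha0, hb0, rfl⟩ := hdec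
    have hba : b + a ∈ aperySet Γ := by rwa [add_comm]
    rw [Finset.mem_coe, Finset.mem_image]
    refine ⟨s(a, b), ?_, rfl⟩
    rw [Finset.mk_mem_sym2_iff, Set.Finite.mem_toFinset, Set.Finite.mem_toFinset]
    exact ⟨⟨⟨left_mem_aperySet ha hb hdA, ha0⟩, hnotQ a b hb hb0 hdA⟩,
      ⟨⟨left_mem_aperySet hb ha hba, hb0⟩, hnotQ b a ha ha0 hba⟩⟩
  have hDle : D.ncard ≤ Nat.choose (N.ncard + 1) 2 := by
    calc D.ncard ≤ (hNfin.toFinset.sym2.image f : Set ℕ).ncard :=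
          Set.ncard_le_ncard hDsub (Finset.finite_toSet _)
      _ ≤ hNfin.toFinset.sym2.card := by
          rw [Set.ncard_coe_finset]
          exact Finset.card_image_le
      _ = Nat.choose (N.ncard + 1) 2 := by
          rw [Finset.card_sym2, Set.ncard_eq_toFinset_card N hNfin]
  omega

/-- There are `C(k+1,2)` distinct sums of two powers `3^i` with `i < k`. -/
theorem exists_sums_of_powers {s k : ℕ} (h : s ≤ Nat.choose (k + 1) 2) :
    ∃ T : Finset ℕ, T.card = s ∧ ∀ t ∈ T, ∃ i < k, ∃ j < k, t = 3 ^ j + 3 ^ i ∧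
      3 ^ j < t ∧ t < 3 ^ (j + 1) := by
  classical
  let U : Finset (Σ _ : ℕ, ℕ) := (Finset.range k).sigma fun j => Finset.range (j + 1)
  have hU : U.card = Nat.choose (k + 1) 2 := by
    simp only [U, Finset.card_sigma, Finset.card_range]
    clear h U
    induction k with
    | zero => rfl
    | succ k ih =>
      rw [Finset.sum_range_succ, ih, Nat.choose_succ_succ' (k + 1) 1, Nat.choose_one_right,
        add_comm]
  let f : (Σ _ : ℕ, ℕ) → ℕ := fun x => 3 ^ x.1 + 3 ^ x.2
  have hbound : ∀ x ∈ U, 3 ^ x.1 < f x ∧ f x < 3 ^ (x.1 + 1) := by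
    intro x hx
    simp only [U, Finset.mem_sigma, Finset.mem_range] at hx
    have h1 : 3 ^ x.2 ≤ 3 ^ x.1 := Nat.pow_le_pow_right (by norm_num) (by omega)
    have h2 : 0 < 3 ^ x.2 := by positivity
    simp only [f, pow_succ]
    omega
  have hinj : Set.InjOn f U := by
    rintro x hx y hy hxy
    have hx1 := hbound x hx
    have hy1 := hbound y hy
    have hfst : x.1 = y.1 := by
      rw [← Nat.log_eq_of_pow_le_of_lt_pow hx1.1.le hx1.2, hxy,
        Nat.log_eq_of_pow_le_of_lt_pow hy1.1.le hy1.2]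
    obtain ⟨j, i⟩ := x
    obtain ⟨j', i'⟩ := y
    obtain rfl : j = j' := hfst
    have : i = i' := Nat.pow_right_injective (by norm_num : 2 ≤ 3)
      (Nat.add_left_cancel hxy)
    rw [this]
  obtain ⟨T, hTsub, hT⟩ := Finset.exists_subset_card_eq
    (s := U.image f) (n := s) (by rwa [Finset.card_image_of_injOn hinj, hU])
  refine ⟨T, hT, fun t ht => ?_⟩
  obtain ⟨x, hx, rfl⟩ := Finset.mem_image.1 (hTsub ht)
  have hx' := hx
  simp only [U, Finset.mem_sigma, Finset.mem_range] at hx'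
  exact ⟨x.2, by omega, x.1, by omega, rfl, hbound x hx⟩

/-- The height function of the extremal monoid: the smallest element with residue `i` is
`m * height A T i + i`. -/
def height (A T : Finset ℕ) (i : ℕ) : ℕ :=
  if i = 0 then 0 else if i ∈ A then 2 else if i ∈ T then 4 else 3

theorem height_le (A T : Finset ℕ) (i : ℕ) : height A T i ≤ 4 := by
  unfold height
  split_ifs <;> norm_num

theorem two_le_height {A T : Finset ℕ} {i : ℕ} (h : i ≠ 0) : 2 ≤ height A T i := by
  unfold height
  split_ifs <;> first | contradiction | norm_num

/-- The monoid whose elements `x` are those with `height A T (x % m) ≤ x / m`. -/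
def heightMonoid (m : ℕ) (A T : Finset ℕ) : AddSubmonoid ℕ where
  carrier := {x | height A T (x % m) ≤ x / m}
  zero_mem' := by simp [height]
  add_mem' := by
    intro x y hx hy
    simp only [Set.mem_ofPred_eq] at *
    have hadd := Nat.div_add_div_le_add_div (x := x) (y := y) (z := m)
    by_cases hx0 : x % m = 0
    · rw [Nat.add_mod, hx0, zero_add, Nat.mod_mod]
      omega
    by_cases hy0 : y % m = 0
    · rw [Nat.add_mod, hy0, add_zero, Nat.mod_mod]
      omega
    have := two_le_height (A := A) (T := T) hx0
    have := two_le_height (A := A) (T := T) hy0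
    have := height_le A T ((x + y) % m)
    omega

theorem mem_heightMonoid {m : ℕ} {A T : Finset ℕ} {x : ℕ} :
    x ∈ heightMonoid m A T ↔ height A T (x % m) ≤ x / m := Iff.rfl

theorem mul_add_mem_heightMonoid_iff {m q i : ℕ} {A T : Finset ℕ} (hi : i < m) :
    m * q + i ∈ heightMonoid m A T ↔ height A T i ≤ q := by
  rw [mem_heightMonoid, Nat.mul_add_mod, Nat.mod_eq_of_lt hi, Nat.mul_add_div (by omega),
    Nat.div_eq_of_lt hi, add_zero]

theorem mul_mem_heightMonoid {m : ℕ} {A T : Finset ℕ} (q : ℕ) : m * q ∈ heightMonoid m A T := by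
  simp [mem_heightMonoid, height]

theorem mem_heightMonoid_of_le {m : ℕ} {A T : Finset ℕ} (hm : 0 < m) {x : ℕ} (hx : m * 4 ≤ x) :
    x ∈ heightMonoid m A T := by
  rw [mem_heightMonoid]
  refine (height_le _ _ _).trans ?_
  rwa [Nat.le_div_iff_mul_le hm, mul_comm]

theorem mul_two_le_of_mem_heightMonoid {m : ℕ} {A T : Finset ℕ} (hm : 0 < m) {x : ℕ}
    (hx : x ∈ heightMonoid m A T) (h0 : x % m ≠ 0) : m * 2 ≤ x := by
  rw [mul_comm, ← Nat.le_div_iff_mul_le hm]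
  exact (two_le_height h0).trans hx

theorem isNumericalMonoid_heightMonoid {m : ℕ} (hm : 0 < m) (A T : Finset ℕ) :
    IsNumericalMonoid (heightMonoid m A T) := by
  refine (Set.finite_Iio (m * 4)).subset fun x hx => ?_
  by_contra h
  exact hx (mem_heightMonoid_of_le hm (not_lt.1 h))

theorem mult_heightMonoid {m : ℕ} (hm : 0 < m) (A T : Finset ℕ) :
    mult (heightMonoid m A T) = m := by
  have hmem : m ∈ heightMonoid m A T := by simpa using mul_mem_heightMonoid (A := A) (T := T) 1
  refine le_antisymm (mult_le hmem hm.ne') (le_csInf ⟨m, hmem, hm.ne'⟩ ?_)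
  rintro x ⟨hx, h0⟩
  by_cases h : x % m = 0
  · exact Nat.le_of_dvd (Nat.pos_of_ne_zero h0) (Nat.dvd_of_mod_eq_zero h)
  · have := mul_two_le_of_mem_heightMonoid hm hx h
    omega

theorem injOn_mul_add {m : ℕ} (q : ℕ → ℕ) : Set.InjOn (fun i => m * q i + i) (Set.Iio m) := by
  intro i hi j hj hij
  have := congrArg (· % m) hij
  simpa [Nat.mul_add_mod, Nat.mod_eq_of_lt hi, Nat.mod_eq_of_lt hj] using this

theorem minGens_heightMonoid {m : ℕ} (hm : 0 < m) {A T : Finset ℕ}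
    (hT : ∀ t ∈ T, t ∉ A ∧ ∃ a ∈ A, ∃ b ∈ A, a ≠ 0 ∧ b ≠ 0 ∧ t = a + b) :
    minGens (heightMonoid m A T) =
      insert m ((fun i => m * height A T i + i) '' (Finset.Ioo 0 m \ T : Finset ℕ)) := by
  have hmem : m ∈ heightMonoid m A T := by simpa using mul_mem_heightMonoid (A := A) (T := T) 1
  ext g
  constructor
  · rintro ⟨hg, hg0, hdec⟩
    obtain ⟨q, i, hi, rfl⟩ : ∃ q i, i < m ∧ g = m * q + i :=
      ⟨g / m, g % m, Nat.mod_lt _ hm, (Nat.div_add_mod g m).symm⟩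
    by_cases hi0 : i = 0
    · subst hi0
      left
      rcases q with _ | _ | q
      · simp at hg0
      · simp
      · exact absurd (by ring)
          (hdec m hmem (m * (q + 1)) (mul_mem_heightMonoid _) hm.ne' (by positivity))
    · right
      rw [mul_add_mem_heightMonoid_iff hi] at hg
      have hq : q = height A T i := by
        by_contra hne
        obtain ⟨c, rfl⟩ : ∃ c, q = c + 1 := ⟨q - 1, by omega⟩
        exact hdec m hmem (m * c + i) ((mul_add_mem_heightMonoid_iff hi).2 (by omega)) hm.ne'
          (by omega) (by ring)
      refine ⟨i, ?_, by simp only [hq]⟩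
      rw [Finset.mem_coe, Finset.mem_sdiff, Finset.mem_Ioo]
      refine ⟨⟨by omega, hi⟩, fun hiT => ?_⟩
      obtain ⟨hiA, a, ha, b, hb, ha0, hb0, rfl⟩ := hT i hiT
      have hq4 : q = 4 := by simp [hq, height, hiA, hiT, ha0]
      refine hdec (m * 2 + a) ((mul_add_mem_heightMonoid_iff (by omega)).2 ?_)
        (m * 2 + b) ((mul_add_mem_heightMonoid_iff (by omega)).2 ?_) (by omega) (by omega)
        (by rw [hq4]; ring)
      · simp [height, ha, ha0]
      · simp [height, hb, hb0]
  · rintro (rfl | ⟨i, hi, rfl⟩)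
    · have := mult_mem_minGens (Γ := heightMonoid g A T) (by rw [mult_heightMonoid hm]; exact hm.ne')
      rwa [mult_heightMonoid hm] at this
    · rw [Finset.mem_coe, Finset.mem_sdiff, Finset.mem_Ioo] at hi
      obtain ⟨⟨hi0, him⟩, hiT⟩ := hi
      refine ⟨(mul_add_mem_heightMonoid_iff him).2 le_rfl, by simp only; omega, ?_⟩
      have hh : height A T i ≤ 3 := by
        unfold height
        split_ifs <;> norm_num
      have hkey : ∀ a ∈ heightMonoid m A T, ∀ b ∈ heightMonoid m A T, a ≠ 0 →
          m * height A T i + i = a + b → a % m ≠ 0 := by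
        intro a _ b hb ha0 he hmod
        obtain ⟨c, rfl⟩ := Nat.dvd_of_mod_eq_zero hmod
        have hc : 0 < c := Nat.pos_of_ne_zero fun h => ha0 (by simp [h])
        have hbm : b % m = i := by
          rw [← Nat.mul_add_mod m c b, ← he, Nat.mul_add_mod, Nat.mod_eq_of_lt him]
        have hbd : height A T i = c + b / m := by
          rw [← Nat.mul_add_div hm, ← he, Nat.mul_add_div hm, Nat.div_eq_of_lt him, add_zero]
        rw [mem_heightMonoid, hbm] at hb
        omega
      intro a ha b hb ha0 hb0 he
      simp only at he
      have h1 := mul_two_le_of_mem_heightMonoid hm ha (hkey a ha b hb ha0 he)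
      have h2 := mul_two_le_of_mem_heightMonoid hm hb (hkey b hb a ha hb0 (by rw [he, add_comm]))
      have h3 : m * height A T i ≤ m * 3 := Nat.mul_le_mul_left m hh
      omega

theorem edim_heightMonoid {m : ℕ} (hm : 0 < m) {A T : Finset ℕ}
    (hT : ∀ t ∈ T, t ∉ A ∧ ∃ a ∈ A, ∃ b ∈ A, a ≠ 0 ∧ b ≠ 0 ∧ t = a + b)
    (hTm : ∀ t ∈ T, t < m) :
    edim (heightMonoid m A T) + T.card = m := by
  have hsub : T ⊆ Finset.Ioo 0 m := fun t ht => by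
    obtain ⟨-, a, -, b, -, ha, -, rfl⟩ := hT t ht
    exact Finset.mem_Ioo.2 ⟨by omega, hTm _ ht⟩
  have hIio : ((Finset.Ioo 0 m \ T : Finset ℕ) : Set ℕ) ⊆ Set.Iio m := fun i hi =>
    (Finset.mem_Ioo.1 (Finset.mem_sdiff.1 hi).1).2
  have hcard := Finset.card_sdiff_add_card_eq_card hsub
  rw [Nat.card_Ioo] at hcard
  rw [edim, minGens_heightMonoid hm hT, Set.ncard_insert_of_notMem,
    ((injOn_mul_add (height A T)).mono hIio).ncard_image, Set.ncard_coe_finset]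
  · omega
  · rintro ⟨i, hi, he⟩
    have h0 := (Finset.mem_Ioo.1 (Finset.mem_sdiff.1 hi).1).1
    have := congrArg (· % m) he
    simp only [Nat.mul_add_mod, Nat.mod_eq_of_lt (hIio hi), Nat.mod_self] at this
    omega

theorem le_numType_heightMonoid {m : ℕ} (hm : 0 < m) (A T : Finset ℕ) :
    m ≤ numType (heightMonoid m A T) + A.card + 1 := by
  have hsub : (fun i => m * (height A T i - 1) + i) '' (Finset.Ioo 0 m \ A : Finset ℕ) ⊆
      pseudoFrobenius (heightMonoid m A T) := by
    rintro _ ⟨i, hi, rfl⟩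
    rw [Finset.mem_coe, Finset.mem_sdiff, Finset.mem_Ioo] at hi
    obtain ⟨⟨hi0, him⟩, hiA⟩ := hi
    have hh : 3 ≤ height A T i := by
      unfold height
      split_ifs <;> omega
    refine ⟨fun h => ?_, fun g hg hg0 => ?_⟩
    · have := (mul_add_mem_heightMonoid_iff him).1 h
      omega
    · by_cases hmod : g % m = 0
      · obtain ⟨c, rfl⟩ := Nat.dvd_of_mod_eq_zero hmod
        have hc : 0 < c := Nat.pos_of_ne_zero fun h => hg0 (by simp [h])
        have : m * (height A T i - 1) + i + m * c = m * (height A T i - 1 + c) + i := by ring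
        simp only [this]
        exact (mul_add_mem_heightMonoid_iff him).2 (by omega)
      · have h1 := mul_two_le_of_mem_heightMonoid hm hg hmod
        have h2 : m * 2 ≤ m * (height A T i - 1) := Nat.mul_le_mul_left m (by omega)
        exact mem_heightMonoid_of_le hm (by simp only; omega)
  have hfin : (pseudoFrobenius (heightMonoid m A T)).Finite :=
    (isNumericalMonoid_heightMonoid hm A T).subset fun p hp => hp.1
  have hle := Set.ncard_le_ncard hsub hfin
  have hIio : ((Finset.Ioo 0 m \ A : Finset ℕ) : Set ℕ) ⊆ Set.Iio m := fun i hi =>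
    (Finset.mem_Ioo.1 (Finset.mem_sdiff.1 hi).1).2
  rw [((injOn_mul_add _).mono hIio).ncard_image, Set.ncard_coe_finset] at hle
  have hcard := Finset.le_card_sdiff A (Finset.Ioo 0 m)
  rw [Nat.card_Ioo] at hcard
  change _ ≤ numType _ at hle
  omega

/-- For each fixed value of m - e = δ, we have 𝒯(e,m) = 𝒟(e,m) for all m ≫ 0. -/
theorem type_max_eq_D_of_fixed_diff :
    ∀ δ : ℕ, 1 ≤ δ →
    ∃ M : ℕ, ∀ m : ℕ, M ≤ m →
      (∀ Γ : AddSubmonoid ℕ, IsNumericalMonoid Γ →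
        edim Γ = (m - δ) + 1 → mult Γ = m → numType Γ ≤ mathcalD (m - δ) m) ∧
      (∃ Γ : AddSubmonoid ℕ, IsNumericalMonoid Γ ∧
        edim Γ = (m - δ) + 1 ∧ mult Γ = m ∧ numType Γ = mathcalD (m - δ) m) := by
  intro δ hδ
  obtain ⟨k, hk, hkle, hkmin⟩ := exists_macLower_two_add (δ - 1)
  refine ⟨3 ^ k + 3 * δ, fun m hM => ?_⟩
  have hpow : 0 < 3 ^ k := by positivity
  have hD : mathcalD (m - δ) m + k + 1 = m := by
    have hlt : m < Nat.choose (m - δ + 2) 2 := by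
      obtain ⟨c, rfl⟩ : ∃ c, m = 3 * δ + c := ⟨m - 3 * δ, by omega⟩
      have he : 3 * δ + c - δ = 2 * δ + c := by omega
      rw [he, Nat.choose_two_right, Nat.lt_iff_add_one_le, Nat.le_div_iff_mul_le (by norm_num),
        show 2 * δ + c + 2 - 1 = 2 * δ + c + 1 by omega]
      nlinarith
    rw [mathcalD_eq (by omega) hlt, show m - (m - δ + 1) = δ - 1 by omega]
    omega
  have hupper : ∀ Γ : AddSubmonoid ℕ, IsNumericalMonoid Γ →
      edim Γ = (m - δ) + 1 → mult Γ = m → numType Γ ≤ mathcalD (m - δ) m := by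
    intro Γ hΓ hedim hmult
    obtain ⟨n, hn, hle⟩ := exists_numType_add_eq hΓ (by omega)
      (Set.finite_of_ncard_ne_zero (s := minGens Γ) (by
        change edim Γ ≠ 0
        omega))
    have := hkmin n (by omega)
    omega
  refine ⟨hupper, ?_⟩
  obtain ⟨T, hTcard, hT⟩ := exists_sums_of_powers hkle
  have hm : 0 < m := by omega
  set A : Finset ℕ := (Finset.range k).image (3 ^ ·) with hA
  have hAmem : ∀ i < k, 3 ^ i ∈ A := fun i hi =>
    Finset.mem_image_of_mem _ (Finset.mem_range.2 hi)
  have hAcard : A.card ≤ k := by simpa using Finset.card_image_le (s := Finset.range k) (f := (3 ^ ·))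
  have hTm : ∀ t ∈ T, t < m := by
    intro t ht
    obtain ⟨i, -, j, hj, -, -, hlt⟩ := hT t ht
    have : 3 ^ (j + 1) ≤ 3 ^ k := Nat.pow_le_pow_right (by norm_num) hj
    omega
  have hTA : ∀ t ∈ T, t ∉ A ∧ ∃ a ∈ A, ∃ b ∈ A, a ≠ 0 ∧ b ≠ 0 ∧ t = a + b := by
    intro t ht
    obtain ⟨i, hi, j, hj, hsum, hgt, hlt⟩ := hT t ht
    refine ⟨fun h => ?_, 3 ^ j, hAmem j hj, 3 ^ i, hAmem i hi, by positivity, by positivity, hsum⟩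
    obtain ⟨l, -, rfl⟩ := Finset.mem_image.1 h
    have h1 := (Nat.pow_lt_pow_iff_right (by norm_num : 1 < 3)).1 hgt
    have h2 := (Nat.pow_lt_pow_iff_right (by norm_num : 1 < 3)).1 hlt
    omega
  have hnum := isNumericalMonoid_heightMonoid hm A T
  have hmult := mult_heightMonoid hm A T
  have hedim : edim (heightMonoid m A T) = m - δ + 1 := by
    have := edim_heightMonoid hm hTA hTm
    omega
  refine ⟨heightMonoid m A T, hnum, hedim, hmult, (hupper _ hnum hedim hmult).antisymm ?_⟩
  have := le_numType_heightMonoid hm A T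
  omega
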